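/- For A ∈ ℝ^{s×s} and B ∈ ℝ^{s×m}, say the pair (A,B) is controllable if the s-step controllability matrix [B, AB, A²B, …, A^{s-1}B] has rank s. Let N, n, m ≥ 1 and let A_i ∈ ℝ^{n×n} and B_i ∈ ℝ^{n×m} for i ∈ Fin N. Then the pair (blockDiagonal (fun i => A_i), blockDiagonal (fun i => B_i)) of size Nn is controllable if and only if each pair (A_i, B_i) is controllable. -/

import Mathlib

open Matrix

/-- The `K`-step controllability matrix `[B, AB, A²B, …, A^{K-1}B]` of the pair `(A, B)`. -/
def ctrbMat {s m : Type*} [Fintype s] [DecidableEq s]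
    (A : Matrix s s ℝ) (B : Matrix s m ℝ) (K : ℕ) : Matrix s (Fin K × m) ℝ :=
  Matrix.of fun i km => (A ^ (km.1 : ℕ) * B) i km.2

/-- The pair `(A, B)` is controllable if its `s`-step controllability matrix has full
row rank `s` (where `s` is the state dimension). -/
def IsControllable {s m : Type*} [Fintype s] [DecidableEq s] [Fintype m]
    (A : Matrix s s ℝ) (B : Matrix s m ℝ) : Prop :=
  (ctrbMat A B (Fintype.card s)).rank = Fintype.card s

theorem ctrb_iff_fin {s m : Type*} [Fintype s] [DecidableEq s] [Fintype m]
    (A : Matrix s s ℝ) (B : Matrix s m ℝ) :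
    IsControllable A B ↔
      ∀ v : s → ℝ, (∀ k < Fintype.card s, v ᵥ* (A ^ k * B) = 0) → v = 0 := by
  unfold IsControllable
  rw [Matrix.rank_eq_finrank_span_row, eq_comm, ← Set.finrank,
    ← linearIndependent_iff_card_eq_finrank_span, ← Matrix.vecMul_injective_iff]
  have key : ∀ v : s → ℝ, v ᵥ* ctrbMat A B (Fintype.card s) = 0 ↔
      ∀ k < Fintype.card s, v ᵥ* (A ^ k * B) = 0 := by
    intro v
    constructor
    · intro h k hk
      ext j
      exact congrFun h (⟨k, hk⟩, j)
    · intro h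
      ext ⟨k, j⟩
      exact congrFun (h k k.2) j
  have h0 := injective_iff_map_eq_zero
    (Matrix.vecMulLinear (R := ℝ) (ctrbMat A B (Fintype.card s)))
  constructor
  · intro h v hv
    exact h0.1 h v ((key v).2 hv)
  · intro h
    exact h0.2 fun v hv => h v ((key v).1 hv)

theorem ctrb_iff_all {s m : Type*} [Fintype s] [DecidableEq s] [Fintype m]
    (A : Matrix s s ℝ) (B : Matrix s m ℝ) :
    IsControllable A B ↔
      ∀ v : s → ℝ, (∀ k : ℕ, v ᵥ* (A ^ k * B) = 0) → v = 0 := by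
  rw [ctrb_iff_fin]
  refine ⟨fun h v hv => h v fun k _ => hv k, fun h v hv => h v fun k => ?_⟩
  rcases isEmpty_or_nonempty s with hs | hs
  · rw [Subsingleton.elim v 0, Matrix.zero_vecMul]
  have hdeg : (Polynomial.X ^ k %ₘ A.charpoly).natDegree < Fintype.card s := by
    rw [← Matrix.charpoly_natDegree_eq_dim A]
    apply Polynomial.natDegree_modByMonic_lt _ (Matrix.charpoly_monic A)
    intro h1
    have := Matrix.charpoly_natDegree_eq_dim A
    rw [h1, Polynomial.natDegree_one] at this
    exact Fintype.card_ne_zero this.symm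
  rw [Matrix.pow_eq_aeval_mod_charpoly, Polynomial.aeval_eq_sum_range' hdeg,
    Matrix.sum_mul, Matrix.vecMul_sum]
  refine Finset.sum_eq_zero fun i hi => ?_
  rw [Matrix.smul_mul, Matrix.vecMul_smul, hv i (Finset.mem_range.1 hi), smul_zero]

theorem vecMul_blockDiagonal_apply {o n m : Type*} [Fintype o] [DecidableEq o] [Fintype n]
    (M : o → Matrix n m ℝ) (v : n × o → ℝ) (j : m) (i : o) :
    (v ᵥ* Matrix.blockDiagonal M) (j, i) = ((fun r => v (r, i)) ᵥ* M i) j := by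
  simp [Matrix.vecMul, dotProduct, Fintype.sum_prod_type, Matrix.blockDiagonal_apply]

/-- **Controllability of block-diagonal pairs.** The pair of block-diagonal matrices
`(blockDiagonal A, blockDiagonal B)` is controllable iff each pair `(A i, B i)` is. -/
theorem blockDiagonal_controllable_iff
    {N n m : ℕ} (hN : 1 ≤ N) (hn : 1 ≤ n) (hm : 1 ≤ m)
    (A : Fin N → Matrix (Fin n) (Fin n) ℝ) (B : Fin N → Matrix (Fin n) (Fin m) ℝ) :
    IsControllable (Matrix.blockDiagonal A) (Matrix.blockDiagonal B) ↔
      ∀ i, IsControllable (A i) (B i) := by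
  simp only [ctrb_iff_all, ← Matrix.blockDiagonal_pow, ← Matrix.blockDiagonal_mul]
  constructor
  · intro h i v hv
    have := h (fun p => if p.2 = i then v p.1 else 0) (fun k => by
      ext ⟨j, i'⟩
      rw [vecMul_blockDiagonal_apply]
      by_cases hi : i' = i
      · subst hi
        simpa using congrFun (hv k) j
      · simp only [hi, if_false]
        exact congrFun (Matrix.zero_vecMul _) j)
    ext r
    simpa using congrFun this (r, i)
  · intro h v hv
    ext ⟨r, i⟩
    refine congrFun (h i (fun r => v (r, i)) fun k => ?_) r
    ext j
    have := congrFun (hv k) (j, i)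
    rw [vecMul_blockDiagonal_apply] at this
    exact this
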